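/- arXiv:1711.09036 — 2 statements merged into one kernel-verified Lean document; each statement's English description precedes it below -/
import Mathlib

section
/- Assume λ > 0, v₀ ∈ ℝ, μ satisfies (aa) and (f1), and let v(t) = v₀ (λ/π) ∫₀^∞ (e^{−rt}/r) G(r) dr. Suppose there exist ϑ ∈ (0,1) and κ, a > 0 such that μ(α) ≤ a α^κ for a.e. α ∈ (0, ϑ). Then there exist c > 0 and T₀ > 1 such that |v(t)| ≤ c / (ln t)^{κ+1} for all t ≥ T₀. -/
open MeasureTheory Set Real

/-- The function `G(r)` from formula (g1). -/
noncomputable def Gfun (μ : ℝ → ℝ) (lam : ℝ) (r : ℝ) : ℝ :=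
  (∫ α in Ioo (0:ℝ) 1, r ^ α * Real.sin (π * α) * μ α) /
    ((lam + ∫ α in Ioo (0:ℝ) 1, r ^ α * Real.cos (π * α) * μ α) ^ 2 +
      (∫ α in Ioo (0:ℝ) 1, r ^ α * Real.sin (π * α) * μ α) ^ 2)

/-- The function `v` from formula (postacv), the solution of `D^(μ)v + λv = 0`, `v(0)=v₀`. -/
noncomputable def vfun (μ : ℝ → ℝ) (lam v₀ : ℝ) (t : ℝ) : ℝ :=
  v₀ * (lam / π) * ∫ r in Ioi (0:ℝ), (Real.exp (-r * t) / r) * Gfun μ lam r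

/-- The gamma integral as a lower Lebesgue integral. -/
lemma lintegral_rpow_mul_exp_neg_mul_Ioi {b s : ℝ} (hb : 0 < b) (hs : 0 < s) :
    ∫⁻ r in Ioi (0:ℝ), ENNReal.ofReal (r ^ (b - 1) * exp (-(s * r))) =
      ENNReal.ofReal ((1 / s) ^ b * Gamma b) := by
  have h := Real.integral_rpow_mul_exp_neg_mul_Ioi hb hs
  have hpos : 0 < (1 / s) ^ b * Gamma b :=
    mul_pos (rpow_pos_of_pos (by positivity) _) (Gamma_pos_of_pos hb)
  rw [← h, ofReal_integral_eq_lintegral_ofReal]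
  · exact Integrable.of_integral_ne_zero (by rw [h]; exact hpos.ne')
  · filter_upwards [ae_restrict_mem measurableSet_Ioi] with r hr
    have : 0 < r := hr
    positivity

lemma sin_pi_mul_mul_Gamma_le {b : ℝ} (h0 : 0 < b) (h1 : b < 1) :
    Real.sin (π * b) * Gamma b ≤ π := by
  have hG : Gamma (b + 1) ≤ 1 := by
    have := convexOn_Gamma.le_max_of_mem_Icc (x := 1) (y := 2) (z := b + 1)
      (by simp) (by simp) ⟨by linarith, by linarith⟩
    simpa [Gamma_one, Gamma_two] using this
  rw [Gamma_add_one h0.ne'] at hG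
  have hs : Real.sin (π * b) ≤ π * b := Real.sin_le (by positivity)
  have := Gamma_pos_of_pos h0
  calc Real.sin (π * b) * Gamma b ≤ π * b * Gamma b := by gcongr
    _ = π * (b * Gamma b) := by ring
    _ ≤ π * 1 := by gcongr
    _ = π := mul_one _

lemma rpow_neg_le_div_log_rpow {ϑ p t : ℝ} (hϑ : 0 < ϑ) (hp : 0 < p) (ht : 1 < t) :
    t ^ (-ϑ) ≤ (p / ϑ) ^ p / Real.log t ^ p := by
  have hlog : 0 < Real.log t := Real.log_pos ht
  have h := Real.log_le_rpow_div (x := t) (by linarith) (div_pos hϑ hp)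
  have h2 : Real.log t ^ p ≤ (t ^ (ϑ / p) / (ϑ / p)) ^ p := by gcongr
  have h3 : (t ^ (ϑ / p) / (ϑ / p)) ^ p = t ^ ϑ * (p / ϑ) ^ p := by
    rw [div_eq_mul_inv, mul_rpow (by positivity) (by positivity), ← rpow_mul (by linarith),
      div_mul_cancel₀ _ hp.ne', inv_div]
  rw [h3] at h2
  have ht0 : 0 < t ^ ϑ := rpow_pos_of_pos (by linarith) _
  rw [rpow_neg (by linarith), le_div_iff₀ (by positivity), inv_mul_le_iff₀ ht0]
  exact h2

lemma integrableOn_rpow_mul_mul {μ f : ℝ → ℝ} (hint : IntegrableOn μ (Ioo 0 1))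
    (hf : Continuous f) (hf1 : ∀ x, |f x| ≤ 1) {r : ℝ} (hr : 0 < r) :
    IntegrableOn (fun α => r ^ α * f α * μ α) (Ioo 0 1) := by
  refine Integrable.bdd_mul (c := max 1 r) hint ?_ ?_
  · exact ((continuous_const.rpow continuous_id (fun _ => Or.inl hr.ne')).mul hf).aestronglyMeasurable
  · filter_upwards [ae_restrict_mem measurableSet_Ioo] with α hα
    rw [norm_mul, norm_eq_abs, norm_eq_abs, abs_of_pos (rpow_pos_of_pos hr _)]
    have : r ^ α ≤ max 1 r := by
      rcases le_total r 1 with h | h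
      · exact (rpow_le_one hr.le h hα.1.le).trans (le_max_left _ _)
      · exact ((rpow_le_rpow_of_exponent_le h hα.2.le).trans_eq (rpow_one r)).trans
          (le_max_right _ _)
    calc r ^ α * |f α| ≤ max 1 r * 1 := by gcongr; exact hf1 α
      _ = _ := mul_one _

lemma sin_pi_mul_pos {α : ℝ} (hα : α ∈ Ioo (0:ℝ) 1) : 0 < Real.sin (π * α) :=
  Real.sin_pos_of_pos_of_lt_pi (mul_pos pi_pos hα.1) (by nlinarith [pi_pos, hα.2])

/-- The weight against `sin (π α)` has positive mass as soon as the weight does. -/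
lemma setIntegral_sin_mul_pos {μ : ℝ → ℝ} (hnn : ∀ α ∈ Icc (0:ℝ) 1, 0 ≤ μ α)
    (hint : IntegrableOn μ (Ioo 0 1)) (hpos : 0 < ∫ α in Ioo (0:ℝ) 1, μ α) :
    0 < ∫ α in Ioo (0:ℝ) 1, Real.sin (π * α) * μ α := by
  have hi : IntegrableOn (fun α => Real.sin (π * α) * μ α) (Ioo 0 1) := by
    simpa using integrableOn_rpow_mul_mul (r := 1) (f := fun α => Real.sin (π * α)) hint
      (by fun_prop) (fun x => abs_sin_le_one _) one_pos
  have hnn1 : 0 ≤ᵐ[volume.restrict (Ioo (0:ℝ) 1)] μ := by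
    filter_upwards [ae_restrict_mem measurableSet_Ioo] with α hα
    exact hnn α ⟨hα.1.le, hα.2.le⟩
  have hnn2 : 0 ≤ᵐ[volume.restrict (Ioo (0:ℝ) 1)] fun α => Real.sin (π * α) * μ α := by
    filter_upwards [ae_restrict_mem measurableSet_Ioo] with α hα
    exact mul_nonneg (sin_pi_mul_pos hα).le (hnn α ⟨hα.1.le, hα.2.le⟩)
  rw [setIntegral_pos_iff_support_of_nonneg_ae hnn1 hint] at hpos
  rw [setIntegral_pos_iff_support_of_nonneg_ae hnn2 hi]
  refine hpos.trans_le (measure_mono fun α hα => ⟨?_, hα.2⟩)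
  exact mul_ne_zero (sin_pi_mul_pos hα.2).ne' hα.1

/-- Linear-in-the-numerator control of `Gfun`, with an error that is harmless away from `0`. -/
lemma exists_abs_Gfun_le {μ : ℝ → ℝ} {lam : ℝ} (hlam : 0 < lam)
    (hnn : ∀ α ∈ Icc (0:ℝ) 1, 0 ≤ μ α) (hint : IntegrableOn μ (Ioo 0 1))
    (hpos : 0 < ∫ α in Ioo (0:ℝ) 1, μ α) :
    ∃ K ≥ 0, ∀ r > 0, |Gfun μ lam r| ≤
      4 / lam ^ 2 * (∫ α in Ioo (0:ℝ) 1, r ^ α * Real.sin (π * α) * μ α) + K * r := by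
  set m := ∫ α in Ioo (0:ℝ) 1, μ α with hm
  set s := ∫ α in Ioo (0:ℝ) 1, Real.sin (π * α) * μ α with hs
  have hs0 : 0 < s := setIntegral_sin_mul_pos hnn hint hpos
  have hsint : IntegrableOn (fun α => Real.sin (π * α) * μ α) (Ioo 0 1) :=
    Integrable.of_integral_ne_zero hs0.ne'
  set q := lam / (lam + 2 * m) with hq
  have hq0 : 0 < q := by positivity
  have hq1 : q < 1 := by rw [hq, div_lt_one (by positivity)]; linarith
  have hqm : q * m ≤ lam / 2 := by
    rw [hq, div_mul_eq_mul_div, div_le_div_iff₀ (by positivity) two_pos]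
    nlinarith
  refine ⟨1 / (q ^ 2 * (q ^ 2 * s)), by positivity, fun r hr => ?_⟩
  set S := ∫ α in Ioo (0:ℝ) 1, r ^ α * Real.sin (π * α) * μ α with hS
  set C := ∫ α in Ioo (0:ℝ) 1, r ^ α * Real.cos (π * α) * μ α with hC
  have hSint := integrableOn_rpow_mul_mul (f := fun α => Real.sin (π * α)) hint
      (by fun_prop) (fun x => abs_sin_le_one _) hr
  have hCint := integrableOn_rpow_mul_mul (f := fun α => Real.cos (π * α)) hint
      (by fun_prop) (fun x => abs_cos_le_one _) hr
  have hS0 : 0 ≤ S := setIntegral_nonneg measurableSet_Ioo fun α hα =>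
    mul_nonneg (mul_nonneg (rpow_nonneg hr.le _) (sin_pi_mul_pos hα).le)
      (hnn α ⟨hα.1.le, hα.2.le⟩)
  have hG : |Gfun μ lam r| = S / ((lam + C) ^ 2 + S ^ 2) :=
    abs_of_nonneg (div_nonneg hS0 (by positivity))
  rw [hG]
  rcases le_total r (q ^ 2) with hrq | hrq
  · have hCge : -(q * m) ≤ C := by
      rw [hm, hC, ← integral_const_mul, ← integral_neg]
      refine setIntegral_mono_on (hint.const_mul q).neg hCint measurableSet_Ioo fun α hα => ?_
      have hμ := hnn α ⟨hα.1.le, hα.2.le⟩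
      rw [← neg_mul]
      refine mul_le_mul_of_nonneg_right ?_ hμ
      rcases le_total α (1 / 2) with h | h
      · have : 0 ≤ Real.cos (π * α) :=
          Real.cos_nonneg_of_neg_pi_div_two_le_of_le (by nlinarith [pi_pos, hα.1])
            (by nlinarith [pi_pos])
        have := mul_nonneg (rpow_nonneg hr.le α) this
        linarith
      · have hr1 : r ≤ 1 := hrq.trans (by nlinarith)
        have h1 : r ^ α ≤ q := calc
          r ^ α ≤ r ^ (1 / 2 : ℝ) := rpow_le_rpow_of_exponent_ge hr hr1 h
          _ = √r := (Real.sqrt_eq_rpow r).symm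
          _ ≤ q := (Real.sqrt_le_left hq0.le).2 hrq
        have := Real.neg_one_le_cos (π * α)
        nlinarith [rpow_pos_of_pos hr α]
    have hden : lam ^ 2 / 4 ≤ (lam + C) ^ 2 + S ^ 2 := by nlinarith [sq_nonneg S]
    have : S / ((lam + C) ^ 2 + S ^ 2) ≤ S / (lam ^ 2 / 4) := by gcongr
    refine this.trans ?_
    have h2 : S / (lam ^ 2 / 4) = 4 / lam ^ 2 * S := by field_simp
    rw [h2, le_add_iff_nonneg_right]
    positivity
  · have hSge : q ^ 2 * s ≤ S := by
      rw [hs, hS, ← integral_const_mul]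
      refine setIntegral_mono_on (hsint.const_mul _) hSint measurableSet_Ioo fun α hα => ?_
      have hμ := hnn α ⟨hα.1.le, hα.2.le⟩
      have hsin := (sin_pi_mul_pos hα).le
      have : q ^ 2 ≤ r ^ α := calc
        q ^ 2 = (q ^ 2) ^ (1:ℝ) := (rpow_one _).symm
        _ ≤ (q ^ 2) ^ α :=
          rpow_le_rpow_of_exponent_ge (by positivity) (by nlinarith) hα.2.le
        _ ≤ r ^ α := rpow_le_rpow (by positivity) hrq hα.1.le
      rw [← mul_assoc]
      gcongr
    have hqs : 0 < q ^ 2 * s := by positivity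
    have hSp : 0 < S := hqs.trans_le hSge
    calc S / ((lam + C) ^ 2 + S ^ 2) ≤ S / S ^ 2 := by
          gcongr; nlinarith [sq_nonneg (lam + C)]
      _ = 1 / S := by field_simp
      _ ≤ 1 / (q ^ 2 * s) := by gcongr
      _ = 1 / (q ^ 2 * (q ^ 2 * s)) * q ^ 2 := by field_simp
      _ ≤ 1 / (q ^ 2 * (q ^ 2 * s)) * r := by gcongr
      _ ≤ _ := le_add_of_nonneg_left (by positivity)

lemma lintegral_exp_div_mul_integral_le {μ : ℝ → ℝ} (hmeas : Measurable μ)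
    (hnn : ∀ α ∈ Icc (0:ℝ) 1, 0 ≤ μ α) {t : ℝ} (ht : 0 < t) :
    ∫⁻ r in Ioi (0:ℝ), ENNReal.ofReal (Real.exp (-r * t) / r *
        ∫ α in Ioo (0:ℝ) 1, r ^ α * Real.sin (π * α) * μ α) ≤
      ∫⁻ α in Ioo (0:ℝ) 1, ENNReal.ofReal (π * (μ α * t ^ (-α))) := by
  calc _ ≤ ∫⁻ r in Ioi (0:ℝ), ∫⁻ α in Ioo (0:ℝ) 1,
        ENNReal.ofReal (Real.exp (-r * t) / r * (r ^ α * Real.sin (π * α) * μ α)) := by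
        refine setLIntegral_mono' measurableSet_Ioi fun r hr => ?_
        have hr0 : 0 < r := hr
        rw [← integral_const_mul]
        refine (ofReal_le_enorm _).trans ((enorm_integral_le_lintegral_enorm _).trans_eq ?_)
        refine setLIntegral_congr_fun measurableSet_Ioo fun α hα => ?_
        refine Real.enorm_of_nonneg (mul_nonneg (by positivity) (mul_nonneg (mul_nonneg
          (rpow_nonneg hr0.le _) (sin_pi_mul_pos hα).le) (hnn α ⟨hα.1.le, hα.2.le⟩)))
    _ = ∫⁻ α in Ioo (0:ℝ) 1, ∫⁻ r in Ioi (0:ℝ),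
        ENNReal.ofReal (Real.exp (-r * t) / r * (r ^ α * Real.sin (π * α) * μ α)) := by
        refine lintegral_lintegral_swap (Measurable.aemeasurable ?_)
        simp only [Function.uncurry_def]
        fun_prop
    _ ≤ _ := by
        refine setLIntegral_mono' measurableSet_Ioo fun α hα => ?_
        have hμ := hnn α ⟨hα.1.le, hα.2.le⟩
        have hsin := (sin_pi_mul_pos hα).le
        have h : ∀ r ∈ Ioi (0:ℝ),
            ENNReal.ofReal (Real.exp (-r * t) / r * (r ^ α * Real.sin (π * α) * μ α)) =
            ENNReal.ofReal (Real.sin (π * α) * μ α) *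
              ENNReal.ofReal (r ^ (α - 1) * Real.exp (-(t * r))) := by
          intro r hr
          have hr0 : 0 < r := hr
          rw [← ENNReal.ofReal_mul (mul_nonneg hsin hμ), rpow_sub_one hr0.ne',
            show -r * t = -(t * r) by ring]
          congr 1
          ring
        rw [setLIntegral_congr_fun measurableSet_Ioi h,
          lintegral_const_mul' _ _ ENNReal.ofReal_ne_top,
          lintegral_rpow_mul_exp_neg_mul_Ioi hα.1 ht, ← ENNReal.ofReal_mul (mul_nonneg hsin hμ)]
        refine ENNReal.ofReal_le_ofReal ?_
        rw [one_div, inv_rpow ht.le, ← rpow_neg ht.le]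
        have := mul_le_mul_of_nonneg_right (sin_pi_mul_mul_Gamma_le hα.1 hα.2)
          (mul_nonneg hμ (rpow_nonneg ht.le (-α)))
        linarith

lemma lintegral_mul_rpow_neg_le {μ : ℝ → ℝ}
    (hnn : ∀ α ∈ Icc (0:ℝ) 1, 0 ≤ μ α) (hint : IntegrableOn μ (Ioo 0 1))
    {ϑ κ a : ℝ} (hϑ : ϑ ∈ Ioo (0:ℝ) 1) (hκ : 0 < κ) (ha : 0 < a)
    (hμbound : ∀ᵐ α ∂(volume.restrict (Ioo 0 ϑ)), μ α ≤ a * α ^ κ) {t : ℝ} (ht : 1 < t) :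
    ∫⁻ α in Ioo (0:ℝ) 1, ENNReal.ofReal (π * (μ α * t ^ (-α))) ≤
      ENNReal.ofReal (π * a * Gamma (κ + 1) / Real.log t ^ (κ + 1) +
        π * (∫ α in Ioo (0:ℝ) 1, μ α) * t ^ (-ϑ)) := by
  have ht0 : 0 < t := by linarith
  have hlog : 0 < Real.log t := Real.log_pos ht
  have hm : 0 ≤ ∫ α in Ioo (0:ℝ) 1, μ α :=
    setIntegral_nonneg measurableSet_Ioo fun α hα => hnn α ⟨hα.1.le, hα.2.le⟩
  have hΓ : 0 < Gamma (κ + 1) := Gamma_pos_of_pos (by linarith)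
  rw [← Ioo_union_Ico_eq_Ioo hϑ.1 hϑ.2.le, ENNReal.ofReal_add (by positivity) (by
    rw [Ioo_union_Ico_eq_Ioo hϑ.1 hϑ.2.le]; positivity)]
  refine (lintegral_union_le _ _ _).trans (add_le_add ?_ ?_)
  · calc _ ≤ ∫⁻ α in Ioo (0:ℝ) ϑ, ENNReal.ofReal (π * a) *
          ENNReal.ofReal (α ^ (κ + 1 - 1) * Real.exp (-(Real.log t * α))) := by
          refine lintegral_mono_ae ?_
          filter_upwards [hμbound] with α hα
          rw [← ENNReal.ofReal_mul (by positivity)]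
          refine ENNReal.ofReal_le_ofReal ?_
          rw [rpow_def_of_pos ht0, add_sub_cancel_right, mul_neg, mul_assoc, ← mul_assoc a]
          gcongr
      _ ≤ ∫⁻ α in Ioi (0:ℝ), ENNReal.ofReal (π * a) *
          ENNReal.ofReal (α ^ (κ + 1 - 1) * Real.exp (-(Real.log t * α))) :=
          lintegral_mono_set Ioo_subset_Ioi_self
      _ = _ := by
          rw [lintegral_const_mul' _ _ ENNReal.ofReal_ne_top,
            lintegral_rpow_mul_exp_neg_mul_Ioi (by linarith) hlog,
            ← ENNReal.ofReal_mul (by positivity), one_div, inv_rpow hlog.le]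
          congr 1
          ring
  · rw [Ioo_union_Ico_eq_Ioo hϑ.1 hϑ.2.le]
    calc _ ≤ ∫⁻ α in Ico ϑ 1, ENNReal.ofReal (π * t ^ (-ϑ)) * ENNReal.ofReal (μ α) := by
          refine setLIntegral_mono' measurableSet_Ico fun α hα => ?_
          have hμ := hnn α ⟨hϑ.1.le.trans hα.1, hα.2.le⟩
          rw [← ENNReal.ofReal_mul (by positivity)]
          refine ENNReal.ofReal_le_ofReal ?_
          have : t ^ (-α) ≤ t ^ (-ϑ) := rpow_le_rpow_of_exponent_le ht.le (neg_le_neg hα.1)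
          rw [mul_assoc, mul_comm (t ^ (-ϑ))]
          gcongr
      _ ≤ ∫⁻ α in Ioo (0:ℝ) 1, ENNReal.ofReal (π * t ^ (-ϑ)) * ENNReal.ofReal (μ α) :=
          lintegral_mono_set fun α hα => ⟨hϑ.1.trans_le hα.1, hα.2⟩
      _ = _ := by
          rw [lintegral_const_mul' _ _ ENNReal.ofReal_ne_top,
            ← ofReal_integral_eq_lintegral_ofReal hint, ← ENNReal.ofReal_mul (by positivity)]
          · congr 1
            ring
          · filter_upwards [ae_restrict_mem measurableSet_Ioo] with α hα
            exact hnn α ⟨hα.1.le, hα.2.le⟩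

lemma lintegral_exp_neg_mul_Ioi {t : ℝ} (ht : 0 < t) :
    ∫⁻ r in Ioi (0:ℝ), ENNReal.ofReal (Real.exp (-r * t)) = ENNReal.ofReal (1 / t) := by
  have h := lintegral_rpow_mul_exp_neg_mul_Ioi one_pos ht
  simpa [mul_comm t] using h

/-- estimate (f11): if moreover `μ(α) ≤ a α^κ` a.e. near `0`,
then `|v(t)| ≤ c / (ln t)^{κ+1}` for `t` large. -/
theorem v_log_power_decay (μ : ℝ → ℝ) (lam v₀ : ℝ) (hlam : 0 < lam)
    (hmeas : Measurable μ)
    (hnn : ∀ α ∈ Icc (0:ℝ) 1, 0 ≤ μ α)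
    (hint : IntegrableOn μ (Ioo 0 1))
    (hpos : 0 < ∫ α in Ioo (0:ℝ) 1, μ α)
    (hf1 : IntegrableOn (fun α => μ α / α) (Ioo 0 1))
    (ϑ : ℝ) (hϑ : ϑ ∈ Ioo (0:ℝ) 1) (κ a : ℝ) (hκ : 0 < κ) (ha : 0 < a)
    (hμbound : ∀ᵐ α ∂(volume.restrict (Ioo 0 ϑ)), μ α ≤ a * α ^ κ) :
    ∃ c > 0, ∃ T₀ > (1:ℝ), ∀ t ≥ T₀,
      |vfun μ lam v₀ t| ≤ c / Real.log t ^ (κ + 1) := by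
  obtain ⟨K, hK, hG⟩ := exists_abs_Gfun_le hlam hnn hint hpos
  set m := ∫ α in Ioo (0:ℝ) 1, μ α
  set D := ((κ + 1) / ϑ) ^ (κ + 1)
  have hϑ0 := hϑ.1
  have hD : 0 < D := by positivity
  have hΓ : 0 < Gamma (κ + 1) := Gamma_pos_of_pos (by linarith)
  set B := 4 / lam ^ 2 * (π * a * Gamma (κ + 1) + π * m * D) + K * D with hB
  have hB0 : 0 ≤ B := by positivity
  refine ⟨|v₀ * (lam / π)| * B + 1, by positivity, 2, one_lt_two, fun t ht => ?_⟩
  have ht1 : 1 < t := by linarith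
  have ht0 : 0 < t := by linarith
  set L := Real.log t ^ (κ + 1)
  have hL : 0 < L := rpow_pos_of_pos (Real.log_pos ht1) _
  have hdec : t ^ (-ϑ) ≤ D / L := rpow_neg_le_div_log_rpow hϑ.1 (by linarith) ht1
  have hinv : 1 / t ≤ D / L := by
    refine le_trans ?_ hdec
    rw [one_div, ← rpow_neg_one]
    exact rpow_le_rpow_of_exponent_le ht1.le (by linarith [hϑ.2])
  have hmain : ∫⁻ r in Ioi (0:ℝ), ‖Real.exp (-r * t) / r * Gfun μ lam r‖ₑ ≤
      ENNReal.ofReal (B / L) := by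
    calc _ ≤ ∫⁻ r in Ioi (0:ℝ), (ENNReal.ofReal (4 / lam ^ 2) *
            ENNReal.ofReal (Real.exp (-r * t) / r *
              ∫ α in Ioo (0:ℝ) 1, r ^ α * Real.sin (π * α) * μ α) +
            ENNReal.ofReal K * ENNReal.ofReal (Real.exp (-r * t))) := by
          refine setLIntegral_mono' measurableSet_Ioi fun r hr => ?_
          have hr0 : 0 < r := hr
          rw [Real.enorm_eq_ofReal_abs, abs_mul, abs_of_pos (by positivity),
            ← ENNReal.ofReal_mul (by positivity), ← ENNReal.ofReal_mul hK]
          refine le_trans (ENNReal.ofReal_le_ofReal ?_) ENNReal.ofReal_add_le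
          refine (mul_le_mul_of_nonneg_left (hG r hr0) (by positivity)).trans_eq ?_
          field_simp
      _ = ENNReal.ofReal (4 / lam ^ 2) * (∫⁻ r in Ioi (0:ℝ),
            ENNReal.ofReal (Real.exp (-r * t) / r *
              ∫ α in Ioo (0:ℝ) 1, r ^ α * Real.sin (π * α) * μ α)) +
            ENNReal.ofReal K * ENNReal.ofReal (1 / t) := by
          rw [lintegral_add_right _ (by fun_prop),
            lintegral_const_mul' _ _ ENNReal.ofReal_ne_top,
            lintegral_const_mul' _ _ ENNReal.ofReal_ne_top, lintegral_exp_neg_mul_Ioi ht0]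
      _ ≤ ENNReal.ofReal (4 / lam ^ 2) * ENNReal.ofReal (π * a * Gamma (κ + 1) / L +
            π * m * t ^ (-ϑ)) + ENNReal.ofReal K * ENNReal.ofReal (1 / t) := by
          gcongr
          exact (lintegral_exp_div_mul_integral_le hmeas hnn ht0).trans
            (lintegral_mul_rpow_neg_le hnn hint hϑ hκ ha hμbound ht1)
      _ ≤ _ := by
          rw [← ENNReal.ofReal_mul (by positivity), ← ENNReal.ofReal_mul hK,
            ← ENNReal.ofReal_add (by positivity) (by positivity)]
          refine ENNReal.ofReal_le_ofReal ?_
          calc _ ≤ 4 / lam ^ 2 * (π * a * Gamma (κ + 1) / L + π * m * (D / L)) +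
                K * (D / L) := by gcongr
            _ = B / L := by rw [hB]; ring
  have hI : |∫ r in Ioi (0:ℝ), Real.exp (-r * t) / r * Gfun μ lam r| ≤ B / L := by
    have := (enorm_integral_le_lintegral_enorm _).trans hmain
    rwa [Real.enorm_eq_ofReal_abs, ENNReal.ofReal_le_ofReal_iff (by positivity)] at this
  calc |vfun μ lam v₀ t| = |v₀ * (lam / π)| *
        |∫ r in Ioi (0:ℝ), Real.exp (-r * t) / r * Gfun μ lam r| := abs_mul _ _
    _ ≤ |v₀ * (lam / π)| * (B / L) := by gcongr
    _ = |v₀ * (lam / π)| * B / L := by ring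
    _ ≤ _ := by gcongr; linarith
end

section
/- Let Ω ⊂ ℝ^N be an open bounded set, p ∈ [1,∞), T > 0, γ ∈ (0,1), and let μ satisfy (aa). Let w be continuous on Ω̄ × [0,T] such that for each x ∈ Ω the function t ↦ w(x,t) is absolutely continuous on [0,T], and (x,t) ↦ t^{1−γ} ∂_t w(x,t) belongs to L^∞(Ω × (0,T)). Then for each t ∈ (0,T]: ‖w(·,t)‖_{L^p(Ω)}^{p−1} · D^(μ)[ s ↦ ‖w(·,s)‖_{L^p(Ω)} ](t) ≤ ∫_Ω D^(μ)[ s ↦ w(x,s) ](t) · |w(x,t)|^{p−2} w(x,t) dx. -/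
open MeasureTheory Set Real

/-- The distributed-order Caputo derivative of an absolutely continuous function
whose a.e. derivative is `f'`:
`(D^(μ)f)(t) = ∫₀¹ (1/Γ(1-α)) (∫₀^t (t-τ)^{-α} f'(τ) dτ) μ(α) dα`. -/
noncomputable def distCaputo (μ : ℝ → ℝ) (f' : ℝ → ℝ) (t : ℝ) : ℝ :=
  ∫ α in Ioo (0:ℝ) 1,
    (1 / Real.Gamma (1 - α)) * (∫ τ in (0:ℝ)..t, (t - τ) ^ (-α) * f' τ) * μ α

/-- The spatial `L^p(Ω)` norm of `w(·,s)`. -/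
noncomputable def lpNorm {N : ℕ} (Ω : Set (Fin N → ℝ)) (p : ℝ)
    (w : (Fin N → ℝ) → ℝ → ℝ) (s : ℝ) : ℝ :=
  (∫ x in Ω, |w x s| ^ p) ^ (1 / p)


theorem Real.continuous_inv_Gamma : Continuous fun s : ℝ => (Real.Gamma s)⁻¹ := by
  have h : (fun s : ℝ => (Real.Gamma s)⁻¹) = fun s : ℝ => ((Complex.Gamma (s : ℂ))⁻¹).re := by
    ext s
    rw [Complex.Gamma_ofReal, ← Complex.ofReal_inv, Complex.ofReal_re]
  rw [h]
  exact Complex.continuous_re.comp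
    (Complex.differentiable_one_div_Gamma.continuous.comp Complex.continuous_ofReal)

theorem continuousOn_sub_rpow {t τ : ℝ} (r : ℝ) (hτ : τ < t) :
    ContinuousOn (fun s : ℝ => (t - s) ^ r) (Icc 0 τ) := by
  refine ContinuousOn.rpow_const (by fun_prop) fun s hs => Or.inl ?_
  have := hs.2
  exact (sub_pos.2 (by linarith)).ne'

theorem integral_mul_sub_rpow {t τ α : ℝ} (hα : 0 < α) (hτ : 0 ≤ τ) (hτt : τ < t) :
    ∫ s in (0:ℝ)..τ, α * (t - s) ^ (-α - 1) = (t - τ) ^ (-α) - t ^ (-α) := by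
  rw [intervalIntegral.integral_const_mul,
    intervalIntegral.integral_comp_sub_left (fun x => x ^ (-α - 1)) t, integral_rpow]
  · rw [sub_zero, sub_add_cancel]
    field_simp
    ring
  · refine Or.inr ⟨by linarith, fun h => ?_⟩
    rw [uIcc_of_le (by linarith)] at h
    linarith [h.1]

theorem sub_rpow_mul_rpow_le {t τ α γ : ℝ} (hα : 0 ≤ α) (hγ : γ ≤ 1) (hτ : 0 < τ) (hτt : τ < t) :
    (t - τ) ^ (-α) * τ ^ (γ - 1) ≤
      (t / 2) ^ (-α) * τ ^ (γ - 1) + (t / 2) ^ (γ - 1) * (t - τ) ^ (-α) := by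
  have ht : 0 < t := hτ.trans hτt
  have h1 : 0 ≤ τ ^ (γ - 1) := rpow_nonneg hτ.le _
  have h2 : 0 ≤ (t - τ) ^ (-α) := rpow_nonneg (by linarith) _
  have h3 : 0 ≤ (t / 2) ^ (-α) := rpow_nonneg (by linarith) _
  have h4 : 0 ≤ (t / 2) ^ (γ - 1) := rpow_nonneg (by linarith) _
  rcases le_total τ (t / 2) with h | h
  · have : (t - τ) ^ (-α) ≤ (t / 2) ^ (-α) :=
      rpow_le_rpow_of_nonpos (by linarith) (by linarith) (by linarith)
    nlinarith [mul_le_mul_of_nonneg_right this h1, mul_nonneg h4 h2]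
  · have : τ ^ (γ - 1) ≤ (t / 2) ^ (γ - 1) :=
      rpow_le_rpow_of_nonpos (by linarith) h (by linarith)
    nlinarith [mul_le_mul_of_nonneg_right this h2, mul_nonneg h3 h1]

theorem intervalIntegrable_sub_rpow {t α : ℝ} (hα : α < 1) :
    IntervalIntegrable (fun τ : ℝ => (t - τ) ^ (-α)) volume 0 t := by
  have h : IntervalIntegrable (fun τ : ℝ => τ ^ (-α)) volume t 0 :=
    intervalIntegral.intervalIntegrable_rpow' (by linarith)
  simpa using h.comp_sub_left t

theorem integrableOn_sub_rpow_mul_rpow {t α γ : ℝ} (ht : 0 < t) (hα : 0 ≤ α) (hα1 : α < 1)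
    (hγ : 0 < γ) (hγ1 : γ ≤ 1) :
    IntegrableOn (fun τ : ℝ => (t - τ) ^ (-α) * τ ^ (γ - 1)) (Ioo 0 t) ∧
    ∫ τ in Ioo 0 t, (t - τ) ^ (-α) * τ ^ (γ - 1) ≤
      (t / 2) ^ (-α) * (t ^ γ / γ) + (t / 2) ^ (γ - 1) * (t ^ (1 - α) / (1 - α)) := by
  have hi : IntervalIntegrable (fun τ : ℝ => τ ^ (γ - 1)) volume 0 t :=
    intervalIntegral.intervalIntegrable_rpow' (by linarith)
  have hj : IntervalIntegrable (fun τ : ℝ => (t - τ) ^ (-α)) volume 0 t :=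
    intervalIntegrable_sub_rpow hα1
  have hk := (hi.const_mul ((t / 2) ^ (-α))).add (hj.const_mul ((t / 2) ^ (γ - 1)))
  have hk' := (intervalIntegrable_iff_integrableOn_Ioo_of_le ht.le).1 hk
  have hint : IntegrableOn (fun τ : ℝ => (t - τ) ^ (-α) * τ ^ (γ - 1)) (Ioo 0 t) := by
    refine hk'.mono' (by fun_prop) ?_
    filter_upwards [ae_restrict_mem measurableSet_Ioo] with τ hτ
    rw [Real.norm_of_nonneg (mul_nonneg (rpow_nonneg (by linarith [hτ.2]) _)
      (rpow_nonneg hτ.1.le _))]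
    exact sub_rpow_mul_rpow_le hα hγ1 hτ.1 hτ.2
  refine ⟨hint, ?_⟩
  calc _ ≤ ∫ τ in Ioo 0 t,
        ((t / 2) ^ (-α) * τ ^ (γ - 1) + (t / 2) ^ (γ - 1) * (t - τ) ^ (-α)) :=
      setIntegral_mono_on hint hk' measurableSet_Ioo
        fun τ hτ => sub_rpow_mul_rpow_le hα hγ1 hτ.1 hτ.2
    _ = _ := by
      rw [← integral_Ioc_eq_integral_Ioo, ← intervalIntegral.integral_of_le ht.le,
        intervalIntegral.integral_add (hi.const_mul _) (hj.const_mul _),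
        intervalIntegral.integral_const_mul, intervalIntegral.integral_const_mul,
        intervalIntegral.integral_comp_sub_left (fun x => x ^ (-α)) t,
        integral_rpow (Or.inl (by linarith)), integral_rpow (Or.inl (by linarith))]
      have h1 : γ - 1 + 1 = γ := by ring
      have h2 : -α + 1 = 1 - α := by ring
      rw [h1, h2, sub_self, sub_zero, zero_rpow hγ.ne', zero_rpow (by linarith), sub_zero, sub_zero]

theorem abs_sub_le_of_abs_deriv_le {u u' : ℝ → ℝ} {t γ C : ℝ} (hγ : 0 < γ)
    (hi : IntervalIntegrable u' volume 0 t)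
    (hu : ∀ s ∈ Icc 0 t, u s = u 0 + ∫ r in (0:ℝ)..s, u' r)
    (hb : ∀ s ∈ Ioo 0 t, |u' s| ≤ C * s ^ (γ - 1)) {a b : ℝ} (ha : 0 ≤ a) (hab : a ≤ b)
    (hbt : b ≤ t) :
    u b - u a = ∫ r in a..b, u' r ∧ |u b - u a| ≤ C / γ * (b ^ γ - a ^ γ) := by
  have hsub : ∀ {x y}, 0 ≤ x → x ≤ y → y ≤ t → IntervalIntegrable u' volume x y := by
    intro x y hx hxy hy
    refine hi.mono_set ?_
    rw [uIcc_of_le hxy, uIcc_of_le (by linarith)]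
    exact Icc_subset_Icc hx hy
  have heq : u b - u a = ∫ r in a..b, u' r := by
    rw [hu b ⟨by linarith, hbt⟩, hu a ⟨ha, by linarith⟩,
      ← intervalIntegral.integral_add_adjacent_intervals (hsub le_rfl ha (hab.trans hbt))
        (hsub ha hab hbt)]
    ring
  refine ⟨heq, ?_⟩
  rw [heq, ← Real.norm_eq_abs]
  have hpow : IntervalIntegrable (fun r : ℝ => C * r ^ (γ - 1)) volume a b :=
    (intervalIntegral.intervalIntegrable_rpow' (by linarith)).const_mul C
  calc ‖∫ r in a..b, u' r‖ ≤ ∫ r in a..b, C * r ^ (γ - 1) := by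
        refine intervalIntegral.norm_integral_le_of_norm_le hab ?_ hpow
        have hne : ∀ᵐ r : ℝ, r ≠ t := by simp [ae_iff, measure_singleton]
        filter_upwards [hne] with r hr hr'
        exact hb r ⟨by linarith [hr'.1], lt_of_le_of_ne (hr'.2.trans hbt) hr⟩
    _ = _ := by
        rw [intervalIntegral.integral_const_mul, integral_rpow (Or.inl (by linarith)),
          sub_add_cancel]
        ring

theorem integral_sub_rpow_mul_deriv {u u' : ℝ → ℝ} {t α γ C : ℝ} (ht : 0 < t)
    (hα : α ∈ Ioo (0:ℝ) 1) (hγ : γ ∈ Ioo (0:ℝ) 1)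
    (hi : IntervalIntegrable u' volume 0 t)
    (hu : ∀ s ∈ Icc 0 t, u s = u 0 + ∫ r in (0:ℝ)..s, u' r)
    (hb : ∀ s ∈ Ioo 0 t, |u' s| ≤ C * s ^ (γ - 1)) :
    IntegrableOn (fun s => α * (t - s) ^ (-α - 1) * (u t - u s)) (Ioo 0 t) ∧
    ∫ τ in (0:ℝ)..t, (t - τ) ^ (-α) * u' τ =
      t ^ (-α) * (u t - u 0) + ∫ s in Ioo 0 t, α * (t - s) ^ (-α - 1) * (u t - u s) := by
  have hiO : IntegrableOn u' (Ioo 0 t) := (intervalIntegrable_iff_integrableOn_Ioo_of_le ht.le).1 hi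
  set ν : Measure ℝ := volume.restrict (Ioo 0 t) with hν
  have hprod : IntegrableOn (fun τ => (t - τ) ^ (-α) * u' τ) (Ioo 0 t) := by
    refine ((integrableOn_sub_rpow_mul_rpow ht hα.1.le hα.2 hγ.1 hγ.2.le).1.const_mul C).mono'
      ((Measurable.aestronglyMeasurable (by fun_prop)).mul hiO.aestronglyMeasurable) ?_
    filter_upwards [ae_restrict_mem measurableSet_Ioo] with τ hτ
    have h1 : 0 ≤ (t - τ) ^ (-α) := rpow_nonneg (by linarith [hτ.2]) _
    rw [norm_mul, Real.norm_of_nonneg h1, Real.norm_eq_abs]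
    nlinarith [mul_le_mul_of_nonneg_left (hb τ hτ) h1]
  -- the triangle kernel
  set k : ℝ → ℝ → ℝ := fun s τ => if s < τ then α * (t - s) ^ (-α - 1) else 0 with hk
  have hkmeas : Measurable fun z : ℝ × ℝ => k z.1 z.2 :=
    Measurable.ite (measurableSet_lt measurable_fst measurable_snd) (by fun_prop) measurable_const
  have hknn : ∀ s ∈ Ioo 0 t, ∀ τ, 0 ≤ k s τ := by
    intro s hs τ
    simp only [hk]
    split_ifs
    · exact mul_nonneg hα.1.le (rpow_nonneg (by linarith [hs.2]) _)
    · exact le_rfl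
  have hind : ∀ τ ∈ Ioo 0 t, (fun s => k s τ) = (Iio τ).indicator
      (fun s => α * (t - s) ^ (-α - 1)) := by
    intro τ _
    ext s
    simp [hk, indicator_apply]
  have hset : ∀ τ ∈ Ioo 0 t, Iio τ ∩ Ioo 0 t = Ioo 0 τ := by
    intro τ hτ
    ext s
    simp only [mem_inter_iff, mem_Iio, mem_Ioo]
    exact ⟨fun h => ⟨h.2.1, h.1⟩, fun h => ⟨h.2, h.1, h.2.trans hτ.2⟩⟩
  have hkint : ∀ τ ∈ Ioo 0 t, Integrable (fun s => k s τ) ν := by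
    intro τ hτ
    rw [hind τ hτ, integrable_indicator_iff measurableSet_Iio, hν, IntegrableOn,
      Measure.restrict_restrict measurableSet_Iio, hset τ hτ]
    exact (((continuousOn_sub_rpow (-α - 1) hτ.2).const_smul α).integrableOn_Icc).mono_set
      Ioo_subset_Icc_self
  have hkval : ∀ τ ∈ Ioo 0 t, ∫ s, k s τ ∂ν = (t - τ) ^ (-α) - t ^ (-α) := by
    intro τ hτ
    rw [hind τ hτ, integral_indicator measurableSet_Iio, hν,
      Measure.restrict_restrict measurableSet_Iio, hset τ hτ, ← integral_Ioc_eq_integral_Ioo,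
      ← intervalIntegral.integral_of_le hτ.1.le, integral_mul_sub_rpow hα.1 hτ.1.le hτ.2]
  have hF : Integrable (Function.uncurry fun s τ => k s τ * u' τ) (ν.prod ν) := by
    have hm : AEStronglyMeasurable (Function.uncurry fun s τ => k s τ * u' τ) (ν.prod ν) :=
      hkmeas.aestronglyMeasurable.mul hiO.aestronglyMeasurable.comp_snd
    rw [integrable_prod_iff' hm]
    constructor
    · filter_upwards [ae_restrict_mem measurableSet_Ioo] with τ hτ
      exact (hkint τ hτ).mul_const (u' τ)
    · refine ((hprod.sub (hiO.const_mul (t ^ (-α)))).norm).congr ?_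
      filter_upwards [ae_restrict_mem measurableSet_Ioo] with τ hτ
      have h1 : ∫ s, ‖k s τ * u' τ‖ ∂ν = (∫ s, k s τ ∂ν) * ‖u' τ‖ := by
        rw [← integral_mul_const]
        refine integral_congr_ae ?_
        filter_upwards [ae_restrict_mem measurableSet_Ioo] with s hs
        rw [norm_mul, Real.norm_of_nonneg (hknn s hs τ)]
      have h2 : 0 ≤ ∫ s, k s τ ∂ν := by
        refine integral_nonneg_of_ae ?_
        filter_upwards [ae_restrict_mem measurableSet_Ioo] with s hs using hknn s hs τ
      simp only [Function.uncurry_apply_pair, Pi.sub_apply]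
      rw [h1, ← sub_mul, ← hkval τ hτ, norm_mul, Real.norm_of_nonneg h2]
  have hinner : ∀ s ∈ Ioo 0 t, ∫ τ, k s τ * u' τ ∂ν = α * (t - s) ^ (-α - 1) * (u t - u s) := by
    intro s hs
    have h1 : (fun τ => k s τ * u' τ) = (Ioi s).indicator
        (fun τ => α * (t - s) ^ (-α - 1) * u' τ) := by
      ext τ
      simp only [hk, indicator_apply, mem_Ioi]
      split_ifs <;> simp
    have h2 : Ioi s ∩ Ioo 0 t = Ioo s t := by
      ext r
      simp only [mem_inter_iff, mem_Ioi, mem_Ioo]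
      exact ⟨fun h => ⟨h.1, h.2.2⟩, fun h => ⟨h.1, hs.1.trans h.1, h.2⟩⟩
    rw [h1, integral_indicator measurableSet_Ioi, hν, Measure.restrict_restrict measurableSet_Ioi,
      h2, integral_const_mul,
      (abs_sub_le_of_abs_deriv_le hγ.1 hi hu hb hs.1.le hs.2.le le_rfl).1,
      intervalIntegral.integral_of_le hs.2.le, integral_Ioc_eq_integral_Ioo]
  constructor
  · refine hF.integral_prod_left.congr ?_
    filter_upwards [ae_restrict_mem measurableSet_Ioo] with s hs using hinner s hs
  · have h1 : ∫ s in Ioo 0 t, α * (t - s) ^ (-α - 1) * (u t - u s) =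
        ∫ τ in Ioo 0 t, ((t - τ) ^ (-α) * u' τ - t ^ (-α) * u' τ) := by
      rw [← setIntegral_congr_fun measurableSet_Ioo hinner]
      change ∫ s, ∫ τ, k s τ * u' τ ∂ν ∂ν = _
      rw [integral_integral_swap hF]
      refine setIntegral_congr_fun measurableSet_Ioo fun τ hτ => ?_
      rw [integral_mul_const, hkval τ hτ, sub_mul]
    have h2 := (abs_sub_le_of_abs_deriv_le hγ.1 hi hu hb le_rfl ht.le le_rfl).1
    rw [intervalIntegral.integral_of_le ht.le, integral_Ioc_eq_integral_Ioo] at h2 ⊢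
    rw [h1, integral_sub hprod (hiO.const_mul _), integral_const_mul, h2]
    ring

theorem exists_kernel_distCaputo {μ : ℝ → ℝ} {t γ : ℝ} (ht : 0 < t) (hγ : γ ∈ Ioo (0:ℝ) 1)
    (hmeas : Measurable μ) (hnn : ∀ α ∈ Icc (0:ℝ) 1, 0 ≤ μ α) (hint : IntegrableOn μ (Ioo 0 1)) :
    ∃ (k₀ : ℝ) (κ : ℝ → ℝ), 0 ≤ k₀ ∧ (∀ s ∈ Ioo 0 t, 0 ≤ κ s) ∧ StronglyMeasurable κ ∧
      IntegrableOn (fun s => κ s * (t ^ γ - s ^ γ)) (Ioo 0 t) ∧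
      ∀ (u u' : ℝ → ℝ) (C : ℝ), IntervalIntegrable u' volume 0 t →
        (∀ s ∈ Icc 0 t, u s = u 0 + ∫ r in (0:ℝ)..s, u' r) →
        (∀ s ∈ Ioo 0 t, |u' s| ≤ C * s ^ (γ - 1)) →
        IntegrableOn (fun s => κ s * (u t - u s)) (Ioo 0 t) ∧
        distCaputo μ u' t = k₀ * (u t - u 0) + ∫ s in Ioo 0 t, κ s * (u t - u s) := by
  set ν : Measure ℝ := volume.restrict (Ioo 0 t) with hν
  set ρ : Measure ℝ := volume.restrict (Ioo 0 1) with hρ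
  set c : ℝ → ℝ := fun α => (Real.Gamma (1 - α))⁻¹ * μ α with hc
  have hcmeas : Measurable c := by
    have := Real.continuous_inv_Gamma.measurable
    have h2 : Measurable fun α : ℝ => (Real.Gamma (1 - α))⁻¹ := this.comp (by fun_prop)
    exact h2.mul hmeas
  have hcnn : ∀ α ∈ Ioo (0:ℝ) 1, 0 ≤ c α := fun α hα =>
    mul_nonneg (inv_nonneg.2 (Real.Gamma_pos_of_pos (by linarith [hα.2])).le)
      (hnn α ⟨hα.1.le, hα.2.le⟩)
  set d : ℝ → ℝ → ℝ := fun α s => c α * (α * (t - s) ^ (-α - 1)) with hd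
  have hdmeas : Measurable fun z : ℝ × ℝ => d z.1 z.2 := by
    have h2 : Measurable fun z : ℝ × ℝ => c z.1 := hcmeas.comp measurable_fst
    exact h2.mul (by fun_prop)
  have hdnn : ∀ α ∈ Ioo (0:ℝ) 1, ∀ s ∈ Ioo 0 t, 0 ≤ d α s := fun α hα s hs =>
    mul_nonneg (hcnn α hα) (mul_nonneg hα.1.le (rpow_nonneg (by linarith [hs.2]) _))
  have hcont : ∀ B : ℝ → ℝ, Continuous B → Integrable (fun α => B α * μ α) ρ := by
    intro B hB
    have h1 : IntegrableOn μ (Icc 0 1) := (integrableOn_Icc_iff_integrableOn_Ioo).2 hint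
    exact (h1.continuousOn_mul hB.continuousOn isCompact_Icc).mono_set Ioo_subset_Icc_self
  have hVnn : ∀ s ∈ Ioo 0 t, 0 < t ^ γ - s ^ γ := fun s hs =>
    sub_pos.2 (rpow_lt_rpow hs.1.le hs.2 hγ.1)
  have hk0 : Integrable (fun α => c α * t ^ (-α)) ρ := by
    have hB : Continuous fun α : ℝ => (Real.Gamma (1 - α))⁻¹ * t ^ (-α) :=
      (Real.continuous_inv_Gamma.comp (by fun_prop : Continuous fun α : ℝ => 1 - α)).mul
        (continuous_const.rpow (by fun_prop) fun _ => Or.inl ht.ne')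
    refine (hcont _ hB).congr (ae_of_all _ fun α => ?_)
    simp only [hc]
    ring
  -- the power `s ^ γ` is the extremal function of the class
  have hpow := fun α (hα : α ∈ Ioo (0:ℝ) 1) =>
    integral_sub_rpow_mul_deriv (u := fun s => s ^ γ) (u' := fun s => γ * s ^ (γ - 1)) (C := γ)
      ht hα hγ ((intervalIntegral.intervalIntegrable_rpow' (by linarith [hγ.1])).const_mul γ)
      (fun s hs => by
        rw [intervalIntegral.integral_const_mul, integral_rpow (Or.inl (by linarith [hγ.1])),
          sub_add_cancel, zero_rpow hγ.1.ne']
        field_simp [hγ.1.ne']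
        ring)
      (fun s hs => by rw [abs_of_nonneg (mul_nonneg hγ.1.le (rpow_nonneg hs.1.le _))])
  have hΦ : Integrable (Function.uncurry fun α s => d α s * (t ^ γ - s ^ γ)) (ρ.prod ν) := by
    have hm : Measurable (Function.uncurry fun α s => d α s * (t ^ γ - s ^ γ)) :=
      hdmeas.mul (by fun_prop)
    rw [integrable_prod_iff hm.aestronglyMeasurable]
    constructor
    · filter_upwards [ae_restrict_mem measurableSet_Ioo] with α hα
      refine ((hpow α hα).1.const_mul (c α)).congr (ae_of_all _ fun s => ?_)
      simp only [hd, Function.uncurry_apply_pair]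
      ring
    · have hB : Continuous fun α : ℝ => γ * ((Real.Gamma (1 - α))⁻¹ * ((t / 2) ^ (-α) * (t ^ γ / γ))
          + (Real.Gamma (2 - α))⁻¹ * ((t / 2) ^ (γ - 1) * t ^ (1 - α))) := by
        have h1 := Real.continuous_inv_Gamma.comp (by fun_prop : Continuous fun α : ℝ => 1 - α)
        have h2 := Real.continuous_inv_Gamma.comp (by fun_prop : Continuous fun α : ℝ => 2 - α)
        have h3 : Continuous fun α : ℝ => (t / 2) ^ (-α) :=
          continuous_const.rpow (by fun_prop) fun _ => Or.inl (by positivity)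
        have h4 : Continuous fun α : ℝ => t ^ (1 - α) :=
          continuous_const.rpow (by fun_prop) fun _ => Or.inl ht.ne'
        exact continuous_const.mul ((h1.mul (h3.mul continuous_const)).add
          (h2.mul (continuous_const.mul h4)))
      refine (hcont _ hB).mono' (hm.norm.stronglyMeasurable.integral_prod_right).aestronglyMeasurable ?_
      filter_upwards [ae_restrict_mem measurableSet_Ioo] with α hα
      have h1α : 0 < 1 - α := by linarith [hα.2]
      have hΓ : Real.Gamma (2 - α) = (1 - α) * Real.Gamma (1 - α) := by
        rw [← Real.Gamma_add_one h1α.ne']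
        ring_nf
      have hΓpos := Real.Gamma_pos_of_pos h1α
      have e1 : ∫ s, ‖Function.uncurry (fun α s => d α s * (t ^ γ - s ^ γ)) (α, s)‖ ∂ν =
          c α * ∫ s in Ioo 0 t, α * (t - s) ^ (-α - 1) * (t ^ γ - s ^ γ) := by
        rw [← integral_const_mul]
        refine setIntegral_congr_fun measurableSet_Ioo fun s hs => ?_
        simp only [Function.uncurry_apply_pair]
        rw [Real.norm_of_nonneg (mul_nonneg (hdnn α hα s hs) (hVnn s hs).le)]
        simp only [hd]
        ring
      rw [e1, Real.norm_of_nonneg (mul_nonneg (hcnn α hα) (setIntegral_nonneg measurableSet_Ioo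
        fun s hs => mul_nonneg (mul_nonneg hα.1.le (rpow_nonneg (by linarith [hs.2]) _))
          (hVnn s hs).le))]
      have e2 := (hpow α hα).2
      have e3 : ∫ τ in (0:ℝ)..t, (t - τ) ^ (-α) * (γ * τ ^ (γ - 1)) =
          γ * ∫ τ in Ioo 0 t, (t - τ) ^ (-α) * τ ^ (γ - 1) := by
        rw [intervalIntegral.integral_of_le ht.le, integral_Ioc_eq_integral_Ioo,
          ← integral_const_mul]
        congr 1 with τ
        ring
      have e4 := (integrableOn_sub_rpow_mul_rpow ht hα.1.le hα.2 hγ.1 hγ.2.le).2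
      have e5 : 0 ≤ t ^ (-α) * (t ^ γ - 0 ^ γ) := by
        rw [zero_rpow hγ.1.ne', sub_zero]
        positivity
      have e6 : ∫ s in Ioo 0 t, α * (t - s) ^ (-α - 1) * (t ^ γ - s ^ γ) ≤
          γ * ((t / 2) ^ (-α) * (t ^ γ / γ) + (t / 2) ^ (γ - 1) * (t ^ (1 - α) / (1 - α))) := by
        have := mul_le_mul_of_nonneg_left e4 hγ.1.le
        linarith [e2, e3]
      refine (mul_le_mul_of_nonneg_left e6 (hcnn α hα)).trans (le_of_eq ?_)
      rw [hΓ]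
      simp only [hc]
      field_simp
  have hκm : StronglyMeasurable fun s => ∫ α, d α s ∂ρ :=
    (hdmeas.stronglyMeasurable).integral_prod_left
  refine ⟨∫ α, c α * t ^ (-α) ∂ρ, fun s => ∫ α, d α s ∂ρ, ?_, ?_, hκm, ?_, ?_⟩
  · exact setIntegral_nonneg measurableSet_Ioo fun α hα =>
      mul_nonneg (hcnn α hα) (rpow_nonneg ht.le _)
  · exact fun s hs => setIntegral_nonneg measurableSet_Ioo fun α hα => hdnn α hα s hs
  · refine hΦ.integral_prod_right.congr (ae_of_all _ fun s => ?_)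
    simp only [Function.uncurry_apply_pair]
    rw [integral_mul_const]
  · intro u u' C hi hu hb
    have hucont : ContinuousOn u (Ioo 0 t) := by
      have h1 : ContinuousOn (fun s => u 0 + ∫ r in (0:ℝ)..s, u' r) (Icc 0 t) := by
        refine continuousOn_const.add ?_
        rw [← uIcc_of_le ht.le]
        exact intervalIntegral.continuousOn_primitive_interval
          ((intervalIntegrable_iff').1 hi)
      exact (h1.congr hu).mono Ioo_subset_Icc_self
    have hum : AEStronglyMeasurable (fun s => u t - u s) ν :=
      aestronglyMeasurable_const.sub (hucont.aestronglyMeasurable measurableSet_Ioo)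
    have hΨ : Integrable (Function.uncurry fun α s => d α s * (u t - u s)) (ρ.prod ν) := by
      refine (hΦ.const_mul (C / γ)).mono' (hdmeas.aestronglyMeasurable.mul hum.comp_snd) ?_
      rw [hρ, hν, Measure.prod_restrict]
      filter_upwards [ae_restrict_mem (measurableSet_Ioo.prod measurableSet_Ioo)] with z hz
      have h1 := (abs_sub_le_of_abs_deriv_le hγ.1 hi hu hb hz.2.1.le hz.2.2.le le_rfl).2
      simp only [Function.uncurry]
      rw [norm_mul, Real.norm_of_nonneg (hdnn _ hz.1 _ hz.2), Real.norm_eq_abs]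
      refine (mul_le_mul_of_nonneg_left h1 (hdnn _ hz.1 _ hz.2)).trans (le_of_eq ?_)
      ring
    refine ⟨hΨ.integral_prod_right.congr (ae_of_all _ fun s => by
      simp only [Function.uncurry_apply_pair]
      rw [integral_mul_const]), ?_⟩
    have e1 : distCaputo μ u' t = ∫ α, (c α * t ^ (-α) * (u t - u 0) +
        ∫ s, d α s * (u t - u s) ∂ν) ∂ρ := by
      refine setIntegral_congr_fun measurableSet_Ioo fun α hα => ?_
      rw [(integral_sub_rpow_mul_deriv ht hα hγ hi hu hb).2]
      have e2 : ∫ s, d α s * (u t - u s) ∂ν =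
          c α * ∫ s in Ioo 0 t, α * (t - s) ^ (-α - 1) * (u t - u s) := by
        rw [← integral_const_mul]
        congr 1 with s
        simp only [hd]
        ring
      rw [e2]
      simp only [hc]
      ring
    have hΨ' : Integrable (fun α => ∫ s, d α s * (u t - u s) ∂ν) ρ := hΨ.integral_prod_left
    rw [e1, integral_add (hk0.mul_const _) hΨ', integral_mul_const,
      integral_integral_swap hΨ]
    congr 2 with s
    rw [integral_mul_const]

theorem deriv_of_abs_sub_le_rpow {f : ℝ → ℝ} {t γ K : ℝ} (ht : 0 < t) (hγ : γ ∈ Ioo (0:ℝ) 1)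
    (hf : ∀ a b, 0 ≤ a → a ≤ b → b ≤ t → |f b - f a| ≤ K * (b ^ γ - a ^ γ)) :
    IntervalIntegrable (deriv f) volume 0 t ∧
    (∀ s ∈ Icc 0 t, f s = f 0 + ∫ r in (0:ℝ)..s, deriv f r) ∧
    ∀ s ∈ Ioo 0 t, |deriv f s| ≤ K * γ * s ^ (γ - 1) := by
  have hac : AbsolutelyContinuousOnInterval f 0 t := by
    have hi : IntervalIntegrable (fun r : ℝ => K * (γ * r ^ (γ - 1))) volume 0 t :=
      ((intervalIntegral.intervalIntegrable_rpow' (by linarith [hγ.1])).const_mul γ).const_mul K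
    have hG := hi.absolutelyContinuousOnInterval_intervalIntegral (left_mem_uIcc (a := 0) (b := t))
    have hGv : ∀ s : ℝ, ∫ r in (0:ℝ)..s, K * (γ * r ^ (γ - 1)) = K * s ^ γ := by
      intro s
      rw [intervalIntegral.integral_const_mul, intervalIntegral.integral_const_mul,
        integral_rpow (Or.inl (by linarith [hγ.1])), sub_add_cancel, zero_rpow hγ.1.ne', sub_zero,
        mul_div_cancel₀ _ hγ.1.ne']
    simp only [hGv] at hG
    have hdist : ∀ a ∈ uIcc 0 t, ∀ b ∈ uIcc 0 t,
        dist (f a) (f b) ≤ dist (K * a ^ γ) (K * b ^ γ) := by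
      rw [uIcc_of_le ht.le]
      intro a ha b hb
      rcases le_total a b with h | h
      · rw [dist_comm, Real.dist_eq, dist_comm, Real.dist_eq, ← mul_sub]
        exact (hf a b ha.1 h hb.2).trans (le_abs_self _)
      · rw [Real.dist_eq, Real.dist_eq, ← mul_sub]
        exact (hf b a hb.1 h ha.2).trans (le_abs_self _)
    refine squeeze_zero' (Filter.Eventually.of_forall fun E =>
      Finset.sum_nonneg fun _ _ => dist_nonneg) ?_ hG
    refine Filter.mem_inf_of_right (Filter.mem_principal.2 fun E hE => ?_)
    exact Finset.sum_le_sum fun i hi => hdist _ (hE.1 i hi).1 _ (hE.1 i hi).2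
  refine ⟨hac.intervalIntegrable_deriv, fun s hs => ?_, fun s hs => ?_⟩
  · have h1 := (hac.mono (c := 0) (d := s) (by
      rw [uIcc_of_le ht.le, uIcc_of_le hs.1]
      exact Icc_subset_Icc_right hs.2)).integral_deriv_eq_sub
    rw [h1]
    ring
  · by_cases hd : DifferentiableAt ℝ f s
    · have hnhds : Icc 0 t ∈ nhds s := Icc_mem_nhds hs.1 hs.2
      have hp : HasDerivAt (fun r : ℝ => K * r ^ γ) (K * (γ * s ^ (γ - 1))) s :=
        (Real.hasDerivAt_rpow_const (Or.inl hs.1.ne')).const_mul K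
      have hm1 : MonotoneOn (fun r => K * r ^ γ - f r) (Icc 0 t) := by
        intro a ha b hb hab
        have := (abs_le.1 (hf a b ha.1 hab hb.2)).2
        simp only
        linarith
      have hm2 : MonotoneOn (fun r => K * r ^ γ + f r) (Icc 0 t) := by
        intro a ha b hb hab
        have := (abs_le.1 (hf a b ha.1 hab hb.2)).1
        simp only
        linarith
      have h1 := hm1.derivWithin_nonneg (x := s)
      have h2 := hm2.derivWithin_nonneg (x := s)
      rw [derivWithin_of_mem_nhds hnhds, (hp.fun_sub hd.hasDerivAt).deriv] at h1
      rw [derivWithin_of_mem_nhds hnhds, (hp.fun_add hd.hasDerivAt).deriv] at h2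
      rw [abs_le]
      constructor <;> linarith
    · have h1 := hf 0 t le_rfl ht.le le_rfl
      rw [zero_rpow hγ.1.ne', sub_zero] at h1
      have hK : 0 ≤ K := nonneg_of_mul_nonneg_left ((abs_nonneg _).trans h1) (rpow_pos_of_pos ht γ)
      rw [deriv_zero_of_not_differentiableAt hd, abs_zero]
      exact mul_nonneg (mul_nonneg hK hγ.1.le) (rpow_nonneg hs.1.le _)

theorem abs_rpow_sub_two_mul_self_le (p a : ℝ) :
    |(|a| ^ (p - 2) * a)| ≤ |a| ^ (p - 1) := by
  rcases eq_or_ne a 0 with rfl | ha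
  · simpa using rpow_nonneg le_rfl (p - 1)
  · rw [abs_mul, abs_of_nonneg (rpow_nonneg (abs_nonneg a) _)]
    have h : p - 1 = p - 2 + 1 := by ring
    rw [h, rpow_add_one (abs_pos.2 ha).ne']

theorem mul_abs_rpow_sub_two_mul_self {p : ℝ} (hp : 1 ≤ p) (a : ℝ) :
    a * (|a| ^ (p - 2) * a) = |a| ^ p := by
  rcases eq_or_ne a 0 with rfl | ha
  · simp [zero_rpow (by linarith : p ≠ 0)]
  · have h : p = p - 2 + 2 := by ring
    nth_rewrite 2 [h]
    rw [rpow_add (abs_pos.2 ha), rpow_two, sq_abs]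
    ring

section FiniteMeasure

variable {X : Type*} [MeasurableSpace X] {m : Measure X} [IsFiniteMeasure m]

theorem abs_integral_rpow_sub_le {p D : ℝ} (hp : 1 ≤ p) {f g : X → ℝ}
    (hf : MemLp f (ENNReal.ofReal p) m) (hg : MemLp g (ENNReal.ofReal p) m) (hD : 0 ≤ D)
    (hfg : ∀ᵐ x ∂m, |f x - g x| ≤ D) :
    |(∫ x, |f x| ^ p ∂m) ^ (1 / p) - (∫ x, |g x| ^ p ∂m) ^ (1 / p)| ≤
      D * m.real univ ^ (1 / p) := by
  have hp0 : 0 < p := by linarith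
  have hpE : (1 : ENNReal) ≤ ENNReal.ofReal p := by
    rw [← ENNReal.ofReal_one]
    exact ENNReal.ofReal_le_ofReal hp
  have hval : ∀ h : X → ℝ, MemLp h (ENNReal.ofReal p) m →
      (∫ x, |h x| ^ p ∂m) ^ (1 / p) = MeasureTheory.lpNorm h (ENNReal.ofReal p) m := by
    intro h hh
    rw [lpNorm_eq_integral_norm_rpow_toReal (by positivity) ENNReal.ofReal_ne_top
      hh.aestronglyMeasurable, ENNReal.toReal_ofReal hp0.le, one_div]
    rfl
  have hsub : MeasureTheory.lpNorm (f - g) (ENNReal.ofReal p) m ≤ D * m.real univ ^ (1 / p) := by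
    rw [← hval _ (hf.sub hg)]
    have h1 : ∫ x, |(f - g) x| ^ p ∂m ≤ D ^ p * m.real univ := by
      calc _ ≤ ∫ x, D ^ p ∂m := by
            refine integral_mono_of_nonneg (ae_of_all _ fun x => rpow_nonneg (abs_nonneg _) _)
              (integrable_const _) ?_
            filter_upwards [hfg] with x hx
            exact rpow_le_rpow (abs_nonneg _) hx hp0.le
        _ = _ := by rw [integral_const, smul_eq_mul, mul_comm]
    calc _ ≤ (D ^ p * m.real univ) ^ (1 / p) :=
          rpow_le_rpow (integral_nonneg fun x => rpow_nonneg (abs_nonneg _) _) h1 (by positivity)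
      _ = _ := by
          rw [mul_rpow (rpow_nonneg hD _) measureReal_nonneg, ← rpow_mul hD,
            mul_one_div_cancel hp0.ne', rpow_one]
  rw [hval f hf, hval g hg, abs_le]
  have h1 := lpNorm_le_lpNorm_add_lpNorm_sub' (f := f) hg hpE
  have h2 := lpNorm_le_lpNorm_add_lpNorm_sub (f := g) hf hpE
  constructor <;> linarith

theorem integral_mul_abs_rpow_sub_two_le {p W : ℝ} (hp : 1 ≤ p) {f g : X → ℝ}
    (hf : AEStronglyMeasurable f m) (hg : AEStronglyMeasurable g m)
    (hfW : ∀ᵐ x ∂m, |f x| ≤ W) (hgW : ∀ᵐ x ∂m, |g x| ≤ W) :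
    ∫ x, f x * (|g x| ^ (p - 2) * g x) ∂m ≤
      (∫ x, |f x| ^ p ∂m) ^ (1 / p) * ((∫ x, |g x| ^ p ∂m) ^ (1 / p)) ^ (p - 1) := by
  have hp0 : 0 < p := by linarith
  have habs : AEStronglyMeasurable (fun x => |f x|) m := hf.norm
  have hgp : AEStronglyMeasurable (fun x => |g x| ^ (p - 1)) m :=
    ((measurable_norm.pow_const (p - 1)).comp_aemeasurable hg.aemeasurable).aestronglyMeasurable
  have hgp' : ∀ᵐ x ∂m, ‖|g x| ^ (p - 1)‖ ≤ W ^ (p - 1) := by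
    filter_upwards [hgW] with x hx
    rw [Real.norm_of_nonneg (rpow_nonneg (abs_nonneg _) _)]
    exact rpow_le_rpow (abs_nonneg _) hx (by linarith)
  have hfm : ∀ q, MemLp (fun x => |f x|) q m := fun q =>
    MemLp.of_bound habs W (by simpa using hfW)
  have hgm : ∀ q, MemLp (fun x => |g x| ^ (p - 1)) q m := fun q =>
    MemLp.of_bound hgp (W ^ (p - 1)) hgp'
  have hle : ∫ x, f x * (|g x| ^ (p - 2) * g x) ∂m ≤ ∫ x, |f x| * |g x| ^ (p - 1) ∂m := by
    have hbd : Integrable (fun x => |f x| * |g x| ^ (p - 1)) m :=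
      (hfm 2).integrable_mul (hgm 2)
    have hpt : ∀ x, ‖f x * (|g x| ^ (p - 2) * g x)‖ ≤ |f x| * |g x| ^ (p - 1) := fun x => by
      rw [norm_mul]
      exact mul_le_mul_of_nonneg_left (abs_rpow_sub_two_mul_self_le p (g x)) (abs_nonneg _)
    exact (le_abs_self _).trans (norm_integral_le_of_norm_le hbd (ae_of_all _ hpt))
  refine hle.trans ?_
  rcases hp.eq_or_lt with rfl | hp1
  · simp
  · have hq := Real.HolderConjugate.conjExponent hp1
    refine (integral_mul_le_Lp_mul_Lq_of_nonneg hq (ae_of_all _ fun x => abs_nonneg _)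
      (ae_of_all _ fun x => rpow_nonneg (abs_nonneg _) _) (hfm _) (hgm _)).trans (le_of_eq ?_)
    have hp1' : p - 1 ≠ 0 := by linarith
    have e1 : ∀ x, (|g x| ^ (p - 1)) ^ p.conjExponent = |g x| ^ p := fun x => by
      rw [← rpow_mul (abs_nonneg _), Real.conjExponent, mul_div_cancel₀ _ hp1']
    simp only [e1]
    rw [← rpow_mul (integral_nonneg fun x => rpow_nonneg (abs_nonneg _) _), Real.conjExponent]
    congr 2
    field_simp

end FiniteMeasure

/-- Proposition `lpda`, inequality (a1): for `w` continuous on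
`Ω̄ × [0,T]`, absolutely continuous in time with `t^{1-γ} ∂_t w ∈ L^∞(Ω×(0,T))`,
one has
`‖w(·,t)‖_{L^p}^{p-1} D^(μ)‖w(·,·)‖_{L^p}(t) ≤ ∫_Ω D^(μ)w(x,·)(t) |w(x,t)|^{p-2} w(x,t) dx`. -/
theorem lp_norm_distCaputo_inequality
    (Nd : ℕ) (Ω : Set (Fin Nd → ℝ)) (hΩopen : IsOpen Ω)
    (hΩbdd : Bornology.IsBounded Ω)
    (p T γ : ℝ) (hp : 1 ≤ p) (hT : 0 < T) (hγ : γ ∈ Ioo (0:ℝ) 1)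
    (μ : ℝ → ℝ) (hmeas : Measurable μ)
    (hnn : ∀ α ∈ Icc (0:ℝ) 1, 0 ≤ μ α)
    (hint : IntegrableOn μ (Ioo 0 1))
    (hpos : 0 < ∫ α in Ioo (0:ℝ) 1, μ α)
    (w wt : (Fin Nd → ℝ) → ℝ → ℝ)
    (hwcont : ContinuousOn (fun q : (Fin Nd → ℝ) × ℝ => w q.1 q.2)
      (closure Ω ×ˢ Icc (0:ℝ) T))
    (hwAC : ∀ x ∈ Ω, IntervalIntegrable (wt x) volume 0 T ∧
      ∀ t ∈ Icc (0:ℝ) T, w x t = w x 0 + ∫ s in (0:ℝ)..t, wt x s)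
    (M : ℝ)
    (hwt : ∀ x ∈ Ω, ∀ t ∈ Ioc (0:ℝ) T, |t ^ (1 - γ) * wt x t| ≤ M) :
    ∀ t ∈ Ioc (0:ℝ) T,
      lpNorm Ω p w t ^ (p - 1) * distCaputo μ (deriv (lpNorm Ω p w)) t ≤
        ∫ x in Ω, distCaputo μ (wt x) t * (|w x t| ^ (p - 2) * w x t) := by
  intro t ht
  have hsub : Icc 0 t ⊆ Icc 0 T := Icc_subset_Icc_right ht.2
  have hclosed : IsCompact (closure Ω) := hΩbdd.isCompact_closure
  obtain ⟨W, hW⟩ := (hclosed.prod (isCompact_Icc (a := (0:ℝ)) (b := T))).exists_bound_of_continuousOn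
    hwcont
  have hWb : ∀ s ∈ Icc 0 T, ∀ᵐ x ∂volume.restrict Ω, |w x s| ≤ W := fun s hs => by
    filter_upwards [ae_restrict_mem hΩopen.measurableSet] with x hx
    exact hW (x, s) ⟨subset_closure hx, hs⟩
  have : IsFiniteMeasure (volume.restrict Ω) :=
    ⟨by rw [Measure.restrict_apply_univ]; exact hΩbdd.measure_lt_top⟩
  have hwm : ∀ s ∈ Icc 0 T, AEStronglyMeasurable (fun x => w x s) (volume.restrict Ω) :=
    fun s hs => (hwcont.comp (f := fun x => (x, s)) (by fun_prop)
      fun x hx => ⟨subset_closure hx, hs⟩).aestronglyMeasurable hΩopen.measurableSet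
  have hwL : ∀ s ∈ Icc 0 T, ∀ q, MemLp (fun x => w x s) q (volume.restrict Ω) :=
    fun s hs q => MemLp.of_bound (hwm s hs) W (hWb s hs)
  have htT : t ∈ Icc 0 T := ⟨ht.1.le, ht.2⟩
  have h0T : (0:ℝ) ∈ Icc 0 T := ⟨le_rfl, hT.le⟩
  -- every `w x` belongs to the class with weight `s ^ (γ - 1)`
  have hwi : ∀ x ∈ Ω, IntervalIntegrable (wt x) volume 0 t := fun x hx =>
    (hwAC x hx).1.mono_set (by rw [uIcc_of_le ht.1.le, uIcc_of_le hT.le]; exact hsub)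
  have hwu : ∀ x ∈ Ω, ∀ s ∈ Icc 0 t, w x s = w x 0 + ∫ r in (0:ℝ)..s, wt x r :=
    fun x hx s hs => (hwAC x hx).2 s (hsub hs)
  have hwb : ∀ x ∈ Ω, ∀ s ∈ Ioo 0 t, |wt x s| ≤ |M| * s ^ (γ - 1) := fun x hx s hs => by
    have h1 := (hwt x hx s ⟨hs.1, hs.2.le.trans ht.2⟩).trans (le_abs_self M)
    have hpos : 0 < s ^ (1 - γ) := rpow_pos_of_pos hs.1 _
    have hinv : s ^ (γ - 1) = (s ^ (1 - γ))⁻¹ := by rw [← rpow_neg hs.1.le, neg_sub]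
    rw [abs_mul, abs_of_pos hpos] at h1
    rw [hinv, ← div_eq_mul_inv, le_div_iff₀ hpos, mul_comm]
    exact h1
  have hwinc : ∀ x ∈ Ω, ∀ a b, 0 ≤ a → a ≤ b → b ≤ t →
      |w x b - w x a| ≤ |M| / γ * (b ^ γ - a ^ γ) := fun x hx a b ha hab hbt =>
    (abs_sub_le_of_abs_deriv_le hγ.1 (hwi x hx) (hwu x hx) (hwb x hx) ha hab hbt).2
  -- so does the spatial norm
  set f : ℝ → ℝ := _root_.lpNorm Ω p w with hf
  have hpow_mono : ∀ {a b : ℝ}, 0 ≤ a → a ≤ b → 0 ≤ |M| / γ * (b ^ γ - a ^ γ) := fun ha hab =>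
    mul_nonneg (div_nonneg (abs_nonneg M) hγ.1.le)
      (sub_nonneg.2 (rpow_le_rpow ha hab hγ.1.le))
  have hfinc : ∀ a b, 0 ≤ a → a ≤ b → b ≤ t → |f b - f a| ≤
      |M| / γ * (volume.restrict Ω).real univ ^ (1 / p) * (b ^ γ - a ^ γ) := by
    intro a b ha hab hbt
    refine (abs_integral_rpow_sub_le (D := |M| / γ * (b ^ γ - a ^ γ)) hp
      (hwL b (hsub ⟨ha.trans hab, hbt⟩) _) (hwL a (hsub ⟨ha, hab.trans hbt⟩) _)
      (hpow_mono ha hab) ?_).trans (le_of_eq (by ring))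
    filter_upwards [ae_restrict_mem hΩopen.measurableSet] with x hx
    exact hwinc x hx a b ha hab hbt
  obtain ⟨hfi, hfu, hfb⟩ := deriv_of_abs_sub_le_rpow ht.1 hγ hfinc
  obtain ⟨k₀, κ, hk₀, hκ, hκm, hκV, hrep⟩ := exists_kernel_distCaputo ht.1 hγ hmeas hnn hint
  obtain ⟨hfκ, hfrep⟩ := hrep f (deriv f) _ hfi hfu hfb
  -- pairing with the dual function
  set g : (Fin Nd → ℝ) → ℝ := fun x => |w x t| ^ (p - 2) * w x t with hg
  have hgm : AEStronglyMeasurable g (volume.restrict Ω) :=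
    ((by fun_prop : Measurable fun y : ℝ => |y| ^ (p - 2) * y).comp_aemeasurable
      (hwm t htT).aemeasurable).aestronglyMeasurable
  have hgb : ∀ x ∈ Ω, |g x| ≤ W ^ (p - 1) := fun x hx =>
    (abs_rpow_sub_two_mul_self_le p (w x t)).trans
      (rpow_le_rpow (abs_nonneg _) (hW (x, t) ⟨subset_closure hx, htT⟩) (by linarith))
  have hwg : ∀ s ∈ Icc 0 T, Integrable (fun x => w x s * g x) (volume.restrict Ω) := fun s hs =>
    ((hwL s hs 1).integrable le_rfl).mul_bdd (c := W ^ (p - 1)) hgm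
      ((ae_restrict_mem hΩopen.measurableSet).mono fun x hx => hgb x hx)
  have hQ : ∀ s ∈ Icc 0 t, f t ^ (p - 1) * (f t - f s) ≤ ∫ x in Ω, (w x t - w x s) * g x := by
    intro s hs
    have h1 : ∫ x in Ω, (w x t - w x s) * g x =
        (∫ x in Ω, w x t * g x) - ∫ x in Ω, w x s * g x := by
      rw [← integral_sub (hwg t htT) (hwg s (hsub hs))]
      simp only [sub_mul]
    have h2 : ∫ x in Ω, w x t * g x = f t ^ (p - 1) * f t := by
      have hnn : 0 ≤ ∫ x in Ω, |w x t| ^ p :=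
        integral_nonneg fun x => rpow_nonneg (abs_nonneg _) _
      have hfnn : 0 ≤ f t := rpow_nonneg hnn _
      have h3 : f t ^ (p - 1) * f t = f t ^ p := by
        have h4 : p - 1 + 1 = p := by ring
        rw [← rpow_add_one' hfnn (by linarith), h4]
      rw [h3]
      simp only [hg, mul_abs_rpow_sub_two_mul_self hp, hf, _root_.lpNorm]
      rw [← rpow_mul hnn, one_div_mul_cancel (by linarith), rpow_one]
    have h5 : ∫ x in Ω, w x s * g x ≤ f s * f t ^ (p - 1) :=
      integral_mul_abs_rpow_sub_two_le hp (hwm s (hsub hs)) (hwm t htT) (hWb s (hsub hs))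
        (hWb t htT)
    rw [h1, h2]
    linarith
  set ν : Measure ℝ := volume.restrict (Ioo 0 t) with hν
  have hprod : Integrable (Function.uncurry fun x s => κ s * (w x t - w x s) * g x)
      ((volume.restrict Ω).prod ν) := by
    have hwj : AEStronglyMeasurable (fun z : (Fin Nd → ℝ) × ℝ => w z.1 z.2)
        ((volume.restrict Ω).prod ν) := by
      rw [hν, Measure.prod_restrict]
      exact (hwcont.mono (prod_mono subset_closure
        (Ioo_subset_Icc_self.trans hsub))).aestronglyMeasurable
        (hΩopen.measurableSet.prod measurableSet_Ioo)
    have hm : AEStronglyMeasurable (Function.uncurry fun x s => κ s * (w x t - w x s) * g x)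
        ((volume.restrict Ω).prod ν) :=
      (hκm.aestronglyMeasurable.comp_snd.mul ((hwm t htT).comp_fst.sub hwj)).mul hgm.comp_fst
    have hV : Integrable (fun z : (Fin Nd → ℝ) × ℝ => κ z.2 * (t ^ γ - z.2 ^ γ))
        ((volume.restrict Ω).prod ν) := Integrable.comp_snd hκV _
    refine (hV.const_mul (|M| / γ * W ^ (p - 1))).mono' hm ?_
    rw [hν, Measure.prod_restrict]
    filter_upwards [ae_restrict_mem (hΩopen.measurableSet.prod measurableSet_Ioo)] with z hz
    have h1 := hwinc z.1 hz.1 z.2 t hz.2.1.le hz.2.2.le le_rfl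
    have h2 := hgb z.1 hz.1
    have h3 := hκ z.2 hz.2
    simp only [Function.uncurry]
    rw [norm_mul, norm_mul, Real.norm_of_nonneg h3, Real.norm_eq_abs, Real.norm_eq_abs]
    calc _ ≤ κ z.2 * (|M| / γ * (t ^ γ - z.2 ^ γ)) * W ^ (p - 1) := by
          gcongr
          exact mul_nonneg h3 (hpow_mono hz.2.1.le hz.2.2.le)
      _ = _ := by ring
  have hprod' : Integrable (fun x => ∫ s, κ s * (w x t - w x s) * g x ∂ν) (volume.restrict Ω) :=
    hprod.integral_prod_left
  have hd0 : Integrable (fun x => (w x t - w x 0) * g x) (volume.restrict Ω) := by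
    simp only [sub_mul]
    exact (hwg t htT).sub (hwg 0 h0T)
  have hinner : ∀ s, ∫ x in Ω, κ s * (w x t - w x s) * g x =
      κ s * ∫ x in Ω, (w x t - w x s) * g x := fun s => by
    rw [← integral_const_mul]
    simp only [mul_assoc]
  have hκQ : Integrable (fun s => κ s * ∫ x in Ω, (w x t - w x s) * g x) ν :=
    hprod.integral_prod_right.congr (ae_of_all _ hinner)
  have hR : ∫ x in Ω, distCaputo μ (wt x) t * g x =
      k₀ * (∫ x in Ω, (w x t - w x 0) * g x) +
        ∫ s, κ s * (∫ x in Ω, (w x t - w x s) * g x) ∂ν := by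
    calc _ = ∫ x in Ω, (k₀ * ((w x t - w x 0) * g x) +
          ∫ s, κ s * (w x t - w x s) * g x ∂ν) := by
          refine setIntegral_congr_fun hΩopen.measurableSet fun x hx => ?_
          rw [(hrep (w x) (wt x) |M| (hwi x hx) (hwu x hx) (hwb x hx)).2, integral_mul_const]
          ring
      _ = _ := by
          rw [integral_add (hd0.const_mul k₀) hprod', integral_const_mul,
            integral_integral_swap hprod]
          simp only [hinner]
  rw [hR, hfrep, mul_add, ← integral_const_mul]
  refine add_le_add ?_ (setIntegral_mono_on (hfκ.const_mul _) hκQ measurableSet_Ioo fun s hs => ?_)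
  · have := mul_le_mul_of_nonneg_left (hQ 0 ⟨le_rfl, ht.1.le⟩) hk₀
    linarith
  · have := mul_le_mul_of_nonneg_left (hQ s ⟨hs.1.le, hs.2.le⟩) (hκ s hs)
    linarith
end
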